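/- For all real y, all naturals N ≥ 1 and n, the polynomial z = Hₙ(x,y;N) satisfies the third-order differential equation (y/N) • X·D³z + y(2 - (n-2)/N) • D²z + X·Dz = n • z, as an identity in ℝ[X]. -/

import Mathlib

open Polynomial

/-- Formal differentiation on `ℝ[X]`, as a linear endomorphism. -/
noncomputable def D : Module.End ℝ (Polynomial ℝ) := Polynomial.derivative

/-- The Quasi-Hermite polynomial `Hₙ(x,y;N) := ((1 + (y/N) • D²)^N)(Xⁿ)`. -/
noncomputable def QH (y : ℝ) (N n : ℕ) : Polynomial ℝ :=
  (((1 : Module.End ℝ (Polynomial ℝ)) + (y / (N : ℝ)) • D ^ 2) ^ N) ((Polynomial.X : Polynomial ℝ) ^ n)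

theorem D_X_mul (p : ℝ[X]) : D (X * p) = p + X * D p := by
  simp [D]

theorem D_D_X_mul (p : ℝ[X]) : D (D (X * p)) = (2 : ℝ) • D p + X * D (D p) := by
  rw [D_X_mul, map_add, D_X_mul]
  module

theorem one_add_smul_D_sq_apply (c : ℝ) (p : ℝ[X]) :
    ((1 : Module.End ℝ ℝ[X]) + c • D ^ 2) p = p + c • D (D p) := by
  simp [pow_two]

theorem commute_D_one_add_smul_D_sq_pow (c : ℝ) (k : ℕ) :
    Commute D (((1 : Module.End ℝ ℝ[X]) + c • D ^ 2) ^ k) :=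
  ((Commute.one_right D).add_right (((Commute.refl D).pow_right 2).smul_right c)).pow_right k

theorem D_one_add_smul_D_sq_pow_apply (c : ℝ) (k : ℕ) (p : ℝ[X]) :
    D ((((1 : Module.End ℝ ℝ[X]) + c • D ^ 2) ^ k) p) =
      (((1 : Module.End ℝ ℝ[X]) + c • D ^ 2) ^ k) (D p) :=
  LinearMap.congr_fun (commute_D_one_add_smul_D_sq_pow c k).eq p

theorem one_add_smul_D_sq_X_mul (c : ℝ) (p : ℝ[X]) :
    ((1 : Module.End ℝ ℝ[X]) + c • D ^ 2) (X * p) =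
      X * ((1 : Module.End ℝ ℝ[X]) + c • D ^ 2) p + (2 * c) • D p := by
  simp only [one_add_smul_D_sq_apply, D_D_X_mul, mul_add, mul_smul_comm]
  module

/-- The commutator of `(1 + c • D²)^(k + 1)` with multiplication by `X`. -/
theorem one_add_smul_D_sq_pow_succ_X_mul (c : ℝ) (k : ℕ) (p : ℝ[X]) :
    (((1 : Module.End ℝ ℝ[X]) + c • D ^ 2) ^ (k + 1)) (X * p) =
      X * (((1 : Module.End ℝ ℝ[X]) + c • D ^ 2) ^ (k + 1)) p +
        (2 * c * (k + 1)) • D ((((1 : Module.End ℝ ℝ[X]) + c • D ^ 2) ^ k) p) := by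
  induction k generalizing p with
  | zero => simp [one_add_smul_D_sq_X_mul, -LinearMap.add_apply]
  | succ k ih =>
    rw [pow_succ, Module.End.mul_apply, one_add_smul_D_sq_X_mul, map_add, ih, map_smul,
      ← D_one_add_smul_D_sq_pow_apply, ← Module.End.mul_apply _ _ p, ← pow_succ,
      ← Module.End.mul_apply _ (1 + c • D ^ 2) p, ← pow_succ]
    push_cast
    module

theorem X_mul_D_X_pow (n : ℕ) : X * D (X ^ n) = (n : ℝ) • (X ^ n : ℝ[X]) := by
  cases n with
  | zero => simp [D]
  | succ n =>
    simp only [D, derivative_X_pow, smul_eq_C_mul, Nat.add_sub_cancel]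
    ring

/-- The third-order ODE satisfied by `z = Hₙ(x,y;N)`:
`(y/N) x z''' + y(2 - (n-2)/N) z'' + x z' = n z`. -/
theorem quasi_hermite_ode (y : ℝ) (N n : ℕ) (hN : 1 ≤ N) :
    (y / (N : ℝ)) • (Polynomial.X * (D ^ 3) (QH y N n)) +
      (y * (2 - ((n : ℝ) - 2) / (N : ℝ))) • (D ^ 2) (QH y N n) +
      Polynomial.X * D (QH y N n) = (n : ℝ) • QH y N n := by
  obtain ⟨k, rfl⟩ : ∃ k, N = k + 1 := ⟨N - 1, by omega⟩
  have hy : y = y / ((k + 1 : ℕ) : ℝ) * (k + 1) := by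
    push_cast
    field_simp
  unfold QH
  set c : ℝ := y / ((k + 1 : ℕ) : ℝ) with hc
  have hcoeff : y * (2 - ((n : ℝ) - 2) / ((k + 1 : ℕ) : ℝ)) = 2 * y - c * ((n : ℝ) - 2) := by
    rw [hc]
    ring
  set w := (((1 : Module.End ℝ ℝ[X]) + c • D ^ 2) ^ k) (X ^ n)
  set z := (((1 : Module.End ℝ ℝ[X]) + c • D ^ 2) ^ (k + 1)) (X ^ n) with hz
  have hzw : z = w + c • D (D w) := by
    rw [hz, pow_succ', Module.End.mul_apply, one_add_smul_D_sq_apply]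
  have euler : (n : ℝ) • z = X * D z + (2 * y) • D (D w) := by
    rw [hz, ← map_smul, ← X_mul_D_X_pow, one_add_smul_D_sq_pow_succ_X_mul,
      ← D_one_add_smul_D_sq_pow_apply, ← D_one_add_smul_D_sq_pow_apply, mul_assoc, ← hy]
  have euler'' : (n : ℝ) • D (D z) =
      (2 : ℝ) • D (D z) + X * D (D (D z)) + (2 * y) • D (D (D (D w))) := by
    simpa only [map_add, map_smul, D_D_X_mul] using congrArg (fun p => D (D p)) euler
  have hzw'' : D (D z) = D (D w) + c • D (D (D (D w))) := by
    simpa only [map_add, map_smul] using congrArg (fun p => D (D p)) hzw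
  have h3 : (D ^ 3) z = D (D (D z)) := by simp [pow_succ]
  have h2 : (D ^ 2) z = D (D z) := by simp [pow_succ]
  rw [hcoeff, h3, h2, euler]
  linear_combination (norm := module) (-c) • euler'' + (2 * y : ℝ) • hzw''
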